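/- Let F be a degree-3 foliation of ℙ²(ℂ). If F degenerates onto F₁ — i.e. the orbit O(F₁) of the foliation F₁ given in the chart z = 1 by ω̄₁ = y³dx + x³(x dy − y dx) is contained in the closure of O(F) in F(3), and O(F) ≠ O(F₁) — then F possesses a nondegenerate singular point m with BB(F,m) = 4, i.e. the Jacobian matrix J of a defining local vector field at m is invertible and (tr J)² = 4·det J (equivalently, its two nonzero eigenvalues are equal). -/

import Mathlib

open MvPolynomial

noncomputable section

/-- Substitution of the linear change of variables on `ℂ³` given by the matrix `M`. -/
def subst3 (M : Matrix (Fin 3) (Fin 3) ℂ) (P : MvPolynomial (Fin 3) ℂ) :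
    MvPolynomial (Fin 3) ℂ :=
  aeval (fun i => ∑ j, C (M i j) * X j) P

/-- Pullback of the 1-form with coefficient vector `Ω` by the linear map of matrix `M`. -/
def pb3 (M : Matrix (Fin 3) (Fin 3) ℂ) (Ω : Fin 3 → MvPolynomial (Fin 3) ℂ) :
    Fin 3 → MvPolynomial (Fin 3) ℂ :=
  fun i => ∑ j, C (M j i) * subst3 M (Ω j)

/-- Two foliations (given by their projective 1-forms) are linearly conjugate:
`T*Ω = c·Ω'` for some `T ∈ GL₃(ℂ)` and `c ∈ ℂ*`. -/
def LinConj3 (Ω Ω' : Fin 3 → MvPolynomial (Fin 3) ℂ) : Prop :=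
  ∃ (M : Matrix (Fin 3) (Fin 3) ℂ) (c : ℂ), IsUnit M.det ∧ c ≠ 0 ∧
    pb3 M Ω = fun i => C c * Ω' i

/-- The orbit of the 1-form `Ω` under pullback by `GL₃(ℂ)` and nonzero rescaling
(the cone over the `PGL₃(ℂ)`-orbit of the corresponding foliation). -/
def OrbitOf (Ω : Fin 3 → MvPolynomial (Fin 3) ℂ) :
    Set (Fin 3 → MvPolynomial (Fin 3) ℂ) :=
  {Ω' | LinConj3 Ω Ω'}

/-- `Ω` defines a degree-`d` foliation of `ℙ²(ℂ)`: it is a nonzero 1-form with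
homogeneous coefficients of degree `d + 1` annihilating the radial vector field and
with no common factor. -/
def IsFolDeg (d : ℕ) (Ω : Fin 3 → MvPolynomial (Fin 3) ℂ) : Prop :=
  Ω ≠ 0 ∧ (∀ i, (Ω i).IsHomogeneous (d + 1)) ∧
    X 0 * Ω 0 + X 1 * Ω 1 + X 2 * Ω 2 = 0 ∧
    ∀ h : MvPolynomial (Fin 3) ℂ, (∀ i, h ∣ Ω i) → IsUnit h

/-- The coefficient vector of a triple of polynomials. -/
def coeffs (Ω : Fin 3 → MvPolynomial (Fin 3) ℂ) : Fin 3 → (Fin 3 →₀ ℕ) → ℂ :=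
  fun i m => coeff m (Ω i)

/-- Closure, inside the space `F(d)` of degree-`d` foliations with its classical
topology (read off on the coefficients), of a set of defining 1-forms. -/
def FClos (d : ℕ) (S : Set (Fin 3 → MvPolynomial (Fin 3) ℂ)) :
    Set (Fin 3 → MvPolynomial (Fin 3) ℂ) :=
  {Ω' | IsFolDeg d Ω' ∧ coeffs Ω' ∈ closure (coeffs '' S)}

/-- `√3` as a complex number. -/
def s3 : ℂ := (Real.sqrt 3 : ℝ)

/-- Projective 1-form of `H₁ : y³dx − x³dy`. -/
def OmH1 : Fin 3 → MvPolynomial (Fin 3) ℂ :=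
  ![X 2 * X 1 ^ 3, -(X 2 * X 0 ^ 3), X 0 ^ 3 * X 1 - X 0 * X 1 ^ 3]

/-- Projective 1-form of `H₂ : x³dx − y³dy`. -/
def OmH2 : Fin 3 → MvPolynomial (Fin 3) ℂ :=
  ![X 2 * X 0 ^ 3, -(X 2 * X 1 ^ 3), X 1 ^ 4 - X 0 ^ 4]

/-- Projective 1-form of `H₃ : y²(3x+y)dx − x²(x+3y)dy`. -/
def OmH3 : Fin 3 → MvPolynomial (Fin 3) ℂ :=
  ![X 2 * (3 * X 0 * X 1 ^ 2 + X 1 ^ 3), -(X 2 * (X 0 ^ 3 + 3 * X 0 ^ 2 * X 1)),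
    X 0 ^ 3 * X 1 - X 0 * X 1 ^ 3]

/-- Projective 1-form of `H₄ : y²(3x+y)dx + x²(x+3y)dy`. -/
def OmH4 : Fin 3 → MvPolynomial (Fin 3) ℂ :=
  ![X 2 * (3 * X 0 * X 1 ^ 2 + X 1 ^ 3), X 2 * (X 0 ^ 3 + 3 * X 0 ^ 2 * X 1),
    -(X 0 ^ 3 * X 1 + 6 * X 0 ^ 2 * X 1 ^ 2 + X 0 * X 1 ^ 3)]

/-- Projective 1-form of `H₅ : 2y³dx + x²(3y−2x)dy`. -/
def OmH5 : Fin 3 → MvPolynomial (Fin 3) ℂ :=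
  ![2 * X 2 * X 1 ^ 3, X 2 * (3 * X 0 ^ 2 * X 1 - 2 * X 0 ^ 3),
    -(2 * X 0 * X 1 ^ 3 + 3 * X 0 ^ 2 * X 1 ^ 2 - 2 * X 0 ^ 3 * X 1)]

/-- Projective 1-form of `H₆ : (4x³−6x²y+4y³)dx + x²(3y−2x)dy`. -/
def OmH6 : Fin 3 → MvPolynomial (Fin 3) ℂ :=
  ![X 2 * (4 * X 0 ^ 3 - 6 * X 0 ^ 2 * X 1 + 4 * X 1 ^ 3),
    X 2 * (3 * X 0 ^ 2 * X 1 - 2 * X 0 ^ 3),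
    -(4 * X 0 ^ 4 - 8 * X 0 ^ 3 * X 1 + 3 * X 0 ^ 2 * X 1 ^ 2 + 4 * X 0 * X 1 ^ 3)]

/-- Projective 1-form of `H₇ : y³dx + x(3y²−x²)dy`. -/
def OmH7 : Fin 3 → MvPolynomial (Fin 3) ℂ :=
  ![X 2 * X 1 ^ 3, X 2 * (3 * X 0 * X 1 ^ 2 - X 0 ^ 3),
    X 0 ^ 3 * X 1 - 4 * X 0 * X 1 ^ 3]

/-- Projective 1-form of `H₈ : x(x²−3y²)dx − 4y³dy`. -/
def OmH8 : Fin 3 → MvPolynomial (Fin 3) ℂ :=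
  ![X 2 * (X 0 ^ 3 - 3 * X 0 * X 1 ^ 2), -(4 * X 2 * X 1 ^ 3),
    -(X 0 ^ 4 - 3 * X 0 ^ 2 * X 1 ^ 2 - 4 * X 1 ^ 4)]

/-- Projective 1-form of `H₉ : y²((−3+i√3)x+2y)dx + x²((1+i√3)x−2i√3·y)dy`. -/
def OmH9 : Fin 3 → MvPolynomial (Fin 3) ℂ :=
  ![X 2 * (C (-3 + Complex.I * s3) * X 0 * X 1 ^ 2 + 2 * X 1 ^ 3),
    X 2 * (C (1 + Complex.I * s3) * X 0 ^ 3 - C (2 * (Complex.I * s3)) * X 0 ^ 2 * X 1),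
    -(C (1 + Complex.I * s3) * X 0 ^ 3 * X 1 + C (-3 - Complex.I * s3) * X 0 ^ 2 * X 1 ^ 2 +
      2 * X 0 * X 1 ^ 3)]

/-- Projective 1-form of
`H₁₁ : (3x³+3√3x²y+3xy²+√3y³)dx + (√3x³+3x²y+3√3xy²+3y³)dy`. -/
def OmH11 : Fin 3 → MvPolynomial (Fin 3) ℂ :=
  ![X 2 * (3 * X 0 ^ 3 + C (3 * s3) * X 0 ^ 2 * X 1 + 3 * X 0 * X 1 ^ 2 + C s3 * X 1 ^ 3),
    X 2 * (C s3 * X 0 ^ 3 + 3 * X 0 ^ 2 * X 1 + C (3 * s3) * X 0 * X 1 ^ 2 + 3 * X 1 ^ 3),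
    -(3 * X 0 ^ 4 + C (4 * s3) * X 0 ^ 3 * X 1 + 6 * X 0 ^ 2 * X 1 ^ 2 +
      C (4 * s3) * X 0 * X 1 ^ 3 + 3 * X 1 ^ 4)]

/-- Projective 1-form of `F₁ : y³dx + x³(x dy − y dx)`. -/
def OmF1 : Fin 3 → MvPolynomial (Fin 3) ℂ :=
  ![X 2 * X 1 ^ 3 - X 0 ^ 3 * X 1, X 0 ^ 4, -(X 0 * X 1 ^ 3)]

/-- Projective 1-form of `F₂ : x³dx + y³(x dy − y dx)`. -/
def OmF2 : Fin 3 → MvPolynomial (Fin 3) ℂ :=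
  ![X 2 * X 0 ^ 3 - X 1 ^ 4, X 0 * X 1 ^ 3, -(X 0 ^ 4)]

/-- Projective 1-form of the Fermat foliation `F₃ : (x³−x)dy − (y³−y)dx`. -/
def OmF3 : Fin 3 → MvPolynomial (Fin 3) ℂ :=
  ![X 1 * X 2 ^ 3 - X 1 ^ 3 * X 2, X 0 ^ 3 * X 2 - X 0 * X 2 ^ 3,
    X 0 * X 1 ^ 3 - X 0 ^ 3 * X 1]

/-- Projective 1-form of `F₄ : (x³+y³)dx + x³(x dy − y dx)`. -/
def OmF4 : Fin 3 → MvPolynomial (Fin 3) ℂ :=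
  ![X 2 * (X 0 ^ 3 + X 1 ^ 3) - X 0 ^ 3 * X 1, X 0 ^ 4, -(X 0 ^ 4 + X 0 * X 1 ^ 3)]

/-- Projective 1-form of `F₅ : y²(y dx + 2x dy) + x³(x dy − y dx)`. -/
def OmF5 : Fin 3 → MvPolynomial (Fin 3) ℂ :=
  ![X 2 * X 1 ^ 3 - X 0 ^ 3 * X 1, 2 * X 0 * X 1 ^ 2 * X 2 + X 0 ^ 4,
    -(3 * X 0 * X 1 ^ 3)]

/-- `F` (given by `Ω`) has a nondegenerate singular point `m` with Baum–Bott invariant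
`BB(F, m) = 4`: in some standard affine chart (`x_k = 1`, coordinates `x_i, x_j`),
the chart vector field vanishes at `m`, its Jacobian matrix at `m` is invertible, and
`(tr J)² = 4·det J`. -/
def NdBB4 (Ω : Fin 3 → MvPolynomial (Fin 3) ℂ) : Prop :=
  ∃ (i j k : Fin 3) (m : Fin 3 → ℂ), i ≠ j ∧ i ≠ k ∧ j ≠ k ∧ m k = 1 ∧
    (∀ l, eval m (Ω l) = 0) ∧
    (eval m (pderiv i (Ω i)) * eval m (pderiv j (Ω j)) -
        eval m (pderiv j (Ω i)) * eval m (pderiv i (Ω j)) ≠ 0) ∧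
    (eval m (pderiv j (Ω i)) - eval m (pderiv i (Ω j))) ^ 2 =
      4 * (eval m (pderiv i (Ω i)) * eval m (pderiv j (Ω j)) -
        eval m (pderiv j (Ω i)) * eval m (pderiv i (Ω j)))

open Matrix in
/-- Jacobian of the homogeneous form. -/
def Jm (Ω : Fin 3 → MvPolynomial (Fin 3) ℂ) (m : Fin 3 → ℂ) : Matrix (Fin 3) (Fin 3) ℂ :=
  Matrix.of fun i j => eval m (pderiv j (Ω i))

/-- Cross product matrix. -/
def crs (m : Fin 3 → ℂ) : Matrix (Fin 3) (Fin 3) ℂ :=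
  !![0, -m 2, m 1; m 2, 0, -m 0; -m 1, m 0, 0]

/-- Chart-free Baum-Bott data. -/
def BBat (Ω : Fin 3 → MvPolynomial (Fin 3) ℂ) (m : Fin 3 → ℂ) (β : ℂ) : Prop :=
  ∃ δ τ : ℂ, m ≠ 0 ∧ (∀ l, eval m (Ω l) = 0) ∧ δ ≠ 0 ∧ τ ^ 2 = β * δ ∧
    (Jm Ω m).adjugate = δ • Matrix.vecMulVec m m ∧ Jm Ω m - (Jm Ω m).transpose = τ • crs m

lemma hom_eval_smul {P : MvPolynomial (Fin 3) ℂ} {n : ℕ} (hP : P.IsHomogeneous n)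
    (s : ℂ) (m : Fin 3 → ℂ) : eval (s • m) P = s ^ n * eval m P := by
  rw [eval_eq', eval_eq', Finset.mul_sum]
  refine Finset.sum_congr rfl fun d hd => ?_
  have h := hP (mem_support_iff.mp hd)
  have h2 : ∑ i, d i = n := by
    rw [← h, Finsupp.weight_apply, Finsupp.sum_fintype] <;> simp
  simp only [Pi.smul_apply, smul_eq_mul, mul_pow, Finset.prod_mul_distrib,
    Finset.prod_pow_eq_pow_sum, h2]
  ring

lemma BBat_smul {Ω : Fin 3 → MvPolynomial (Fin 3) ℂ} (hΩ : ∀ i, (Ω i).IsHomogeneous 4)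
    {m : Fin 3 → ℂ} {β : ℂ} (h : BBat Ω m β) {s : ℂ} (hs : s ≠ 0) : BBat Ω (s • m) β := by
  obtain ⟨δ, τ, hm, h0, hδ, hβ, hA, hT⟩ := h
  have hJ : Jm Ω (s • m) = s ^ 3 • Jm Ω m := by
    ext i j
    simpa [Jm] using hom_eval_smul ((hΩ i).pderiv (i := j)) s m
  refine ⟨s ^ 4 * δ, s ^ 2 * τ, smul_ne_zero hs hm, fun l => ?_, by positivity, ?_, ?_, ?_⟩
  · rw [hom_eval_smul (hΩ l), h0, mul_zero]
  · rw [mul_pow, hβ]; ring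
  · rw [hJ, Matrix.adjugate_smul, hA]
    ext i j
    simp [Matrix.vecMulVec_apply]; ring
  · rw [hJ, Matrix.transpose_smul, ← smul_sub, hT]
    ext i j
    fin_cases i <;> fin_cases j <;> simp [crs] <;> ring

lemma BBat_norm {Ω : Fin 3 → MvPolynomial (Fin 3) ℂ} (hΩ : ∀ i, (Ω i).IsHomogeneous 4)
    {m : Fin 3 → ℂ} {β : ℂ} (h : BBat Ω m β) : ∃ k n, n k = 1 ∧ BBat Ω n β := by
  have hm : m ≠ 0 := by obtain ⟨_, _, hm, _⟩ := h; exact hm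
  obtain ⟨k, hk⟩ := Function.ne_iff.mp hm
  have hk' : m k ≠ 0 := hk
  exact ⟨k, (m k)⁻¹ • m, by simp [hk'], BBat_smul hΩ h (inv_ne_zero hk')⟩

lemma eval_subst3 (M : Matrix (Fin 3) (Fin 3) ℂ) (m : Fin 3 → ℂ) (P : MvPolynomial (Fin 3) ℂ) :
    eval m (subst3 M P) = eval (M.mulVec m) P := by
  unfold subst3
  induction P using MvPolynomial.induction_on with
  | C a => simp
  | add p q hp hq => rw [map_add, map_add, hp, hq, map_add]
  | mul_X p n hp => rw [map_mul, map_mul, hp, map_mul]; simp [Matrix.mulVec, dotProduct]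

lemma pderiv_subst3 (M : Matrix (Fin 3) (Fin 3) ℂ) (P : MvPolynomial (Fin 3) ℂ) (i : Fin 3) :
    pderiv i (subst3 M P) = ∑ l, C (M l i) * subst3 M (pderiv l P) := by
  unfold subst3
  induction P using MvPolynomial.induction_on with
  | C a => simp
  | add p q hp hq => simp only [map_add, hp, hq, mul_add, Finset.sum_add_distrib]
  | mul_X p n hp =>
    have h1 : pderiv i (∑ j, C (M n j) * X j : MvPolynomial (Fin 3) ℂ) = C (M n i) := by
      simp [pderiv_X, Pi.single_apply]
    rw [map_mul, aeval_X, Derivation.leibniz, hp, h1]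
    simp only [Derivation.leibniz, map_add, smul_eq_mul, map_mul, aeval_X, mul_add,
      Finset.sum_add_distrib, pderiv_X, Pi.single_apply]
    congr 1
    · simp [mul_comm, apply_ite]
    · rw [Finset.mul_sum]
      exact Finset.sum_congr rfl fun _ _ => by ring

lemma Jm_pb3 (M : Matrix (Fin 3) (Fin 3) ℂ) (Ω : Fin 3 → MvPolynomial (Fin 3) ℂ)
    (m : Fin 3 → ℂ) : Jm (pb3 M Ω) m = M.transpose * Jm Ω (M.mulVec m) * M := by
  ext i j
  simp only [Jm, pb3, Matrix.of_apply, map_sum, pderiv_C_mul,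
    pderiv_subst3, map_mul, eval_C, eval_subst3, Matrix.mul_apply,
    Matrix.transpose_apply, Finset.sum_mul, Finset.mul_sum]
  rw [Finset.sum_comm]
  refine Finset.sum_congr rfl fun _ _ => Finset.sum_congr rfl fun _ _ => by ring

lemma crs_conj (N : Matrix (Fin 3) (Fin 3) ℂ) (v : Fin 3 → ℂ) :
    N.transpose * crs (N.mulVec v) * N = N.det • crs v := by
  ext i j
  fin_cases i <;> fin_cases j <;>
    simp [crs, Matrix.mul_apply, Fin.sum_univ_three, Matrix.mulVec, dotProduct,
      Matrix.det_fin_three] <;> ring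

lemma BBat_conj {Ω Ω' : Fin 3 → MvPolynomial (Fin 3) ℂ} (hc : LinConj3 Ω Ω')
    {m : Fin 3 → ℂ} {β : ℂ} (h : BBat Ω' m β) : ∃ n, BBat Ω n β := by
  obtain ⟨M, c, hM, hc0, hpb⟩ := hc
  obtain ⟨δ, τ, hm, h0, hδ, hβ, hA, hT⟩ := h
  have hNM : M⁻¹ * M = 1 := Matrix.nonsing_inv_mul M hM
  have hMN : M * M⁻¹ = 1 := Matrix.mul_nonsing_inv M hM
  set N := M⁻¹ with hN
  have hNd : N.det ≠ 0 := by
    intro h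
    have := congrArg Matrix.det hNM
    simp [h] at this
  have hadj : N.adjugate = N.det • M := by
    calc N.adjugate = N.adjugate * (N * M) := by rw [hNM, mul_one]
      _ = _ := by rw [← mul_assoc, Matrix.adjugate_mul]; simp
  have hNm : N.mulVec (M.mulVec m) = m := by
    rw [Matrix.mulVec_mulVec, hNM, Matrix.one_mulVec]
  have hJ : Jm Ω (M.mulVec m) = c • (N.transpose * Jm Ω' m * N) := by
    have h1 : Jm (pb3 M Ω) m = c • Jm Ω' m := by
      rw [hpb]; ext i j; simp [Jm, Derivation.leibniz]
    have h2 : N.transpose * (Jm (pb3 M Ω) m) * N = Jm Ω (M.mulVec m) := by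
      rw [Jm_pb3]
      have : N.transpose * M.transpose = 1 := by
        rw [← Matrix.transpose_mul, hMN, Matrix.transpose_one]
      rw [← mul_assoc, ← mul_assoc, this, one_mul, mul_assoc, hMN, mul_one]
    rw [← h2, h1]; simp
  refine ⟨M.mulVec m, c ^ 2 * N.det ^ 2 * δ, c * N.det * τ, ?_, ?_, ?_, ?_, ?_, ?_⟩
  · intro h; apply hm; rw [← hNm, h, Matrix.mulVec_zero]
  · have h1 : ∀ i, ∑ l, M l i * eval (M.mulVec m) (Ω l) = 0 := by
      intro i
      have := congrArg (eval m) (congrFun hpb i)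
      simpa [pb3, eval_subst3, h0] using this
    have h2 : M.transpose.mulVec (fun l => eval (M.mulVec m) (Ω l)) = 0 := by
      ext i; simpa [Matrix.mulVec, dotProduct] using h1 i
    have h3 : N.transpose.mulVec (M.transpose.mulVec (fun l => eval (M.mulVec m) (Ω l))) = 0 := by
      rw [h2, Matrix.mulVec_zero]
    rw [Matrix.mulVec_mulVec, ← Matrix.transpose_mul, hMN, Matrix.transpose_one,
      Matrix.one_mulVec] at h3
    exact fun l => congrFun h3 l
  · positivity
  · rw [mul_pow, hβ]; ring
  · rw [hJ, Matrix.adjugate_smul, Matrix.adjugate_mul_distrib, Matrix.adjugate_mul_distrib,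
      ← Matrix.adjugate_transpose, hadj, hA]
    have : Matrix.vecMulVec (M.mulVec m) (M.mulVec m)
        = M * Matrix.vecMulVec m m * M.transpose := by
      ext i j
      simp [Matrix.mul_apply, Fin.sum_univ_three, Matrix.mulVec, dotProduct,
        Matrix.vecMulVec_apply]; ring
    rw [this]
    simp only [Matrix.transpose_smul, Matrix.smul_mul, Matrix.mul_smul, smul_smul, mul_assoc,
      Fintype.card_fin]
    congr 1; ring
  · rw [hJ]
    have : (c • (N.transpose * Jm Ω' m * N)) - (c • (N.transpose * Jm Ω' m * N)).transpose
        = c • (N.transpose * (Jm Ω' m - (Jm Ω' m).transpose) * N) := by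
      simp only [Matrix.transpose_smul, Matrix.transpose_mul, Matrix.transpose_transpose,
        Matrix.mul_sub, Matrix.sub_mul, smul_sub, mul_assoc]
    rw [this, hT]
    have h5 := crs_conj N (M.mulVec m)
    rw [hNm] at h5
    rw [Matrix.mul_smul, Matrix.smul_mul, h5]
    simp only [smul_smul]; congr 1; ring

lemma BBat_nd {Ω : Fin 3 → MvPolynomial (Fin 3) ℂ} (hΩ : ∀ i, (Ω i).IsHomogeneous 4)
    {m : Fin 3 → ℂ} (h : BBat Ω m 4) : NdBB4 Ω := by
  obtain ⟨k, n, hk, δ, τ, hm, h0, hδ, hβ, hA, hT⟩ := BBat_norm hΩ h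
  have hA' := congrFun (congrFun hA k) k
  rw [Matrix.adjugate_fin_three] at hA'
  fin_cases k
  · have hT' := congrFun (congrFun hT 1) 2
    refine ⟨1, 2, 0, n, by decide, by decide, by decide, hk, h0, ?_⟩
    simp [Jm, crs, Matrix.vecMulVec_apply] at hA' hT' hk
    rw [hA', hT', hk]
    exact ⟨by simpa using hδ, by linear_combination hβ⟩
  · have hT' := congrFun (congrFun hT 0) 2
    refine ⟨0, 2, 1, n, by decide, by decide, by decide, hk, h0, ?_⟩
    simp [Jm, crs, Matrix.vecMulVec_apply] at hA' hT' hk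
    rw [hA', hT', hk]
    exact ⟨by simpa using hδ, by linear_combination hβ⟩
  · have hT' := congrFun (congrFun hT 0) 1
    refine ⟨0, 1, 2, n, by decide, by decide, by decide, hk, h0, ?_⟩
    simp [Jm, crs, Matrix.vecMulVec_apply] at hA' hT' hk
    rw [hA', hT', hk]
    exact ⟨by simpa using hδ, by linear_combination hβ⟩

lemma taylor1 (m : Fin 3 → ℂ) (f : MvPolynomial (Fin 3) ℂ) :
    ∃ h : Fin 3 → MvPolynomial (Fin 3) ℂ, f = C (eval m f) + ∑ l, h l * (X l - C (m l)) ∧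
      ∀ l, eval m (h l) = eval m (pderiv l f) := by
  induction f using MvPolynomial.induction_on with
  | C a => exact ⟨0, by simp, by simp⟩
  | add p q hp hq =>
    obtain ⟨h, h1, h2⟩ := hp
    obtain ⟨g, g1, g2⟩ := hq
    refine ⟨h + g, ?_, by simp [h2, g2]⟩
    simp only [Pi.add_apply, add_mul, Finset.sum_add_distrib, map_add]
    linear_combination h1 + g1
  | mul_X p n hp =>
    obtain ⟨h, h1, h2⟩ := hp
    refine ⟨fun l => C (m n) * h l + (if l = n then p else 0), ?_, ?_⟩
    · simp only [add_mul, Finset.sum_add_distrib, ite_mul, zero_mul, Finset.sum_ite_eq',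
        Finset.mem_univ, if_true, mul_assoc, ← Finset.mul_sum, map_mul, eval_X]
      linear_combination (C (m n)) * h1
    · intro l
      simp only [map_add, map_mul, eval_C, h2, Derivation.leibniz, pderiv_X, Pi.single_apply,
        smul_eq_mul, eval_X]
      by_cases hln : l = n
      · subst hln; simp; ring
      · simp [hln, Ne.symm hln]

lemma finite_chart (Ω : Fin 3 → MvPolynomial (Fin 3) ℂ) (k : Fin 3) :
    {m : Fin 3 → ℂ | m k = 1 ∧ (∀ l, eval m (Ω l) = 0) ∧ (Jm Ω m).adjugate k k ≠ 0}.Finite := by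
  set q : Fin 3 → MvPolynomial (Fin 3) ℂ := Function.update Ω k (X k - 1) with hq
  set I : Ideal (MvPolynomial (Fin 3) ℂ) := Ideal.span (Set.range q) with hI
  have hfin := Ideal.finite_minimalPrimes_of_isNoetherianRing _ I
  let g : (Fin 3 → ℂ) → Ideal (MvPolynomial (Fin 3) ℂ) := fun m => RingHom.ker (eval m)
  refine Set.Finite.of_finite_image (f := g) (hfin.subset ?_) ?_
  · rintro _ ⟨m, ⟨hk, h0, hA⟩, rfl⟩
    have hq0 : ∀ i, eval m (q i) = 0 := by
      intro i
      by_cases h : i = k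
      · subst h; simp [hq, hk]
      · simp [hq, h, h0]
    refine ⟨⟨RingHom.ker_isPrime _, ?_⟩, ?_⟩
    · rw [hI, Ideal.span_le]
      rintro _ ⟨i, rfl⟩
      exact hq0 i
    · rintro P ⟨hP, hIP⟩ hPm
      choose h h1 h2 using fun i => taylor1 m (q i)
      let H : Matrix (Fin 3) (Fin 3) (MvPolynomial (Fin 3) ℂ) := Matrix.of h
      have hHdet : eval m H.det = (Jm Ω m).adjugate k k := by
        rw [Matrix.adjugate_apply, RingHom.map_det]
        congr 1
        ext i j
        simp only [RingHom.mapMatrix_apply, Matrix.map_apply, H, Matrix.of_apply, h2]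
        by_cases hi : i = k
        · subst hi; simp [hq, pderiv_X, Pi.single_apply, eq_comm, apply_ite]
        · simp [hq, hi, Jm]
      have hHP : H.det ∉ P := fun hh => hA (by rw [← hHdet]; exact hPm hh)
      let v : Fin 3 → MvPolynomial (Fin 3) ℂ := fun l => X l - C (m l)
      have hHv : H.mulVec v = q := by
        ext1 i
        conv_rhs => rw [h1 i, hq0]
        simp [H, v, Matrix.mulVec, dotProduct]
      have hdv : ∀ l, H.det * v l ∈ P := by
        intro l
        have : H.adjugate.mulVec q = H.det • v := by
          rw [← hHv, Matrix.mulVec_mulVec, Matrix.adjugate_mul, Matrix.smul_mulVec,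
            Matrix.one_mulVec]
        have h3 := congrFun this l
        simp only [Pi.smul_apply, smul_eq_mul] at h3
        rw [← h3, Matrix.mulVec, dotProduct]
        refine P.sum_mem fun i _ => P.mul_mem_left _ (hIP (Ideal.subset_span ⟨i, rfl⟩))
      have hv : ∀ l, v l ∈ P := fun l => (hP.mem_or_mem (hdv l)).resolve_left hHP
      intro f hf
      obtain ⟨u, hu, -⟩ := taylor1 m f
      have hf' : eval m f = 0 := hf
      rw [hu, hf', C_0, zero_add]
      exact P.sum_mem fun i _ => P.mul_mem_left _ (hv i)
  · intro m _ m' _ hmm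
    ext l
    have : (X l - C (m' l) : MvPolynomial (Fin 3) ℂ) ∈ g m := by
      rw [hmm]; simp [g, RingHom.mem_ker]
    simpa [g, RingHom.mem_ker, sub_eq_zero] using this

lemma finite_BB {Ω : Fin 3 → MvPolynomial (Fin 3) ℂ} (hΩ : ∀ i, (Ω i).IsHomogeneous 4) :
    {β | ∃ m, BBat Ω m β}.Finite := by
  refine Set.Finite.subset (Set.finite_iUnion fun k => (finite_chart Ω k).image fun m =>
    (Jm Ω m (k+1) (k+2) - Jm Ω m (k+2) (k+1)) ^ 2 / (Jm Ω m).adjugate k k) ?_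
  rintro β ⟨m, h⟩
  obtain ⟨k, n, hk, δ, τ, hm, h0, hδ, hβ, hA, hT⟩ := BBat_norm hΩ h
  have hA' : (Jm Ω n).adjugate k k = δ := by
    rw [hA]; simp [Matrix.vecMulVec_apply, hk]
  have hT' : Jm Ω n (k+1) (k+2) - Jm Ω n (k+2) (k+1) = - τ := by
    have := congrFun (congrFun hT (k+1)) (k+2)
    simp only [Matrix.sub_apply, Matrix.transpose_apply] at this
    rw [this]
    fin_cases k <;> simp [crs] at hk ⊢ <;> simp [hk]
  refine Set.mem_iUnion.mpr ⟨k, n, ⟨hk, h0, by rwa [hA']⟩, ?_⟩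
  simp only [hA', hT', neg_sq, hβ]
  field_simp

/-- Degree 4 exponents. -/
abbrev SS : Finset (Fin 3 →₀ ℕ) := Finset.finsuppAntidiag Finset.univ 4

/-- Coefficient space. -/
abbrev EE := Fin 3 → SS → ℂ

/-- Polynomial from coefficients. -/
def Pc (c : EE) : Fin 3 → MvPolynomial (Fin 3) ℂ := fun i => ∑ d : SS, monomial d.1 (c i d)

/-- Restriction of the coefficients. -/
def Rc (a : Fin 3 → (Fin 3 →₀ ℕ) → ℂ) : EE := fun i d => a i d.1

lemma Pc_Rc {Ω : Fin 3 → MvPolynomial (Fin 3) ℂ} (hΩ : ∀ i, (Ω i).IsHomogeneous 4) :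
    Pc (Rc (coeffs Ω)) = Ω := by
  funext i
  ext d
  simp only [Pc, Rc, _root_.coeffs, coeff_sum, coeff_monomial]
  rw [Finset.sum_coe_sort SS (fun x => if x = d then coeff x (Ω i) else 0), Finset.sum_ite_eq']
  split_ifs with h
  · rfl
  · by_contra h2
    apply h
    have h3 := hΩ i (Ne.symm h2)
    rw [Finset.mem_finsuppAntidiag]
    refine ⟨?_, Finset.subset_univ _⟩
    rw [← h3, Finsupp.weight_apply, Finsupp.sum_fintype] <;> simp

/-- Chart point. -/
def pt (v : ℂ × ℂ) : Fin 3 → ℂ := ![v.1, 1, v.2]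

lemma eval_Pc (c : EE) (i : Fin 3) (v : ℂ × ℂ) :
    eval (pt v) (Pc c i) = ∑ d : SS, c i d * (v.1 ^ d.1 0 * v.2 ^ d.1 2) := by
  simp [Pc, pt, eval_monomial, Finsupp.prod_fintype, Fin.prod_univ_three]

lemma eval_pderiv_Pc (c : EE) (i j : Fin 3) (v : ℂ × ℂ) :
    eval (pt v) (pderiv j (Pc c i)) = ∑ d : SS, c i d * d.1 j *
      (v.1 ^ (d.1 - Finsupp.single j 1 : Fin 3 →₀ ℕ) 0 * v.2 ^ (d.1 - Finsupp.single j 1 : Fin 3 →₀ ℕ) 2) := by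
  simp only [Pc, map_sum, pderiv_monomial, eval_monomial]
  simp [pt, Finsupp.prod_fintype, Fin.prod_univ_three]

lemma cont_J (i j : Fin 3) : Continuous fun p : EE × (ℂ × ℂ) => Jm (Pc p.1) (pt p.2) i j := by
  simp only [Jm, Matrix.of_apply, eval_pderiv_Pc]
  fun_prop

/-- The chart map. -/
def GG (p : EE × (ℂ × ℂ)) : ℂ × ℂ := (eval (pt p.2) (Pc p.1 0), eval (pt p.2) (Pc p.1 2))

lemma contDiff_GG : ContDiff ℂ 1 GG := by
  unfold GG
  simp only [eval_Pc]
  fun_prop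

lemma homF1 : ∀ i, (OmF1 i).IsHomogeneous 4 := by
  have hX : ∀ i : Fin 3, (X i : MvPolynomial (Fin 3) ℂ).IsHomogeneous 1 :=
    fun i => isHomogeneous_X _ _
  intro i
  fin_cases i
  · exact (((hX 2).mul ((hX 1).pow 3))).sub (((hX 0).pow 3).mul (hX 1))
  · exact (hX 0).pow 4
  · exact ((hX 0).mul ((hX 1).pow 3)).neg

/-- Base point. -/
def c0 : EE := Rc (coeffs OmF1)

lemma Pc_c0 : Pc c0 = OmF1 := Pc_Rc homF1

lemma GG_c0 (v : ℂ × ℂ) : GG (c0, v) = (v.2 - v.1 ^ 3, - v.1) := by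
  simp only [GG, Pc_c0]
  simp [OmF1, pt]

open Topology Filter in
lemma GG_zero {U : Set (EE × (ℂ × ℂ))} (hU : U ∈ 𝓝 ((c0, (0, 0)) : EE × (ℂ × ℂ))) :
    ∀ᶠ c in 𝓝 c0, ∃ v, (c, v) ∈ U ∧ GG (c, v) = 0 := by
  set a : EE × (ℂ × ℂ) := (c0, (0, 0)) with ha
  have hG : HasStrictFDerivAt GG (fderiv ℂ GG a) a :=
    contDiff_GG.contDiffAt.hasStrictFDerivAt (by norm_num)
  set G' := fderiv ℂ GG a with hG'
  have hH : HasStrictFDerivAt (fun p : EE × (ℂ × ℂ) => (p.1, GG p))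
      ((ContinuousLinearMap.fst ℂ EE (ℂ × ℂ)).prod G') a :=
    hasStrictFDerivAt_fst.prodMk hG
  have hpart : ∀ v : ℂ × ℂ, G' (0, v) = (v.2, - v.1) := by
    have h1 : HasFDerivAt (fun v : ℂ × ℂ => GG (c0, v))
        (G'.comp (ContinuousLinearMap.inr ℂ EE (ℂ × ℂ))) (0, 0) :=
      HasFDerivAt.comp (g := GG) ((0, 0) : ℂ × ℂ) hG.hasFDerivAt
        (hasFDerivAt_prodMk_right c0 ((0, 0) : ℂ × ℂ))
    have h2 : HasFDerivAt (fun v : ℂ × ℂ => ((v.2 - v.1 ^ 3, - v.1) : ℂ × ℂ))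
        (((ContinuousLinearMap.snd ℂ ℂ ℂ) -
          (3 * (0 : ℂ) ^ 2) • (ContinuousLinearMap.fst ℂ ℂ ℂ)).prod
          (-(ContinuousLinearMap.fst ℂ ℂ ℂ))) (0, 0) := by
      have hf : HasFDerivAt (fun v : ℂ × ℂ => v.1) (ContinuousLinearMap.fst ℂ ℂ ℂ)
        ((0, 0) : ℂ × ℂ) := hasFDerivAt_fst
      have hs : HasFDerivAt (fun v : ℂ × ℂ => v.2) (ContinuousLinearMap.snd ℂ ℂ ℂ)
        ((0, 0) : ℂ × ℂ) := hasFDerivAt_snd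
      have hp := hf.pow 3
      refine HasFDerivAt.prodMk ((hs.sub hp).congr_fderiv ?_) hf.neg
      simp
    simp only [GG_c0] at h1
    have h3 := h1.unique h2
    intro v
    have := DFunLike.congr_fun h3 v
    simpa using this
  have hmap := hH.map_nhds_eq_of_surj (by
    rw [LinearMap.range_eq_top]
    rintro ⟨c, w⟩
    refine ⟨(c, (-(w - G' (c, 0)).2, (w - G' (c, 0)).1)), ?_⟩
    have h4 : ∀ v : ℂ × ℂ, G' (c, v) = G' (c, 0) + (v.2, -v.1) := by
      intro v
      rw [← hpart, ← map_add]; simp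
    have h5 : G' (c, (-(w - G' (c, 0)).2, (w - G' (c, 0)).1)) = w := by
      rw [h4]; ext <;> simp
    exact Prod.ext rfl h5)
  have himg := image_mem_map (m := fun p : EE × (ℂ × ℂ) => (p.1, GG p)) hU
  rw [hmap] at himg
  have hGa : GG a = 0 := by rw [ha, GG_c0]; simp
  rw [hGa] at himg
  have hc : Tendsto (fun c : EE => (c, (0 : ℂ × ℂ))) (𝓝 c0) (𝓝 (c0, 0)) :=
    (Continuous.prodMk_left (0 : ℂ × ℂ)).tendsto c0
  filter_upwards [hc himg] with c hcc
  obtain ⟨⟨c', v⟩, hp, he⟩ := hcc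
  simp only [Prod.mk.injEq] at he
  obtain ⟨rfl, he⟩ := he
  exact ⟨v, hp, he⟩

/-- The minor. -/
def dl (p : EE × (ℂ × ℂ)) : ℂ :=
  Jm (Pc p.1) (pt p.2) 0 0 * Jm (Pc p.1) (pt p.2) 2 2 -
    Jm (Pc p.1) (pt p.2) 0 2 * Jm (Pc p.1) (pt p.2) 2 0

/-- The trace. -/
def ta (p : EE × (ℂ × ℂ)) : ℂ := Jm (Pc p.1) (pt p.2) 0 2 - Jm (Pc p.1) (pt p.2) 2 0

lemma alg_BB (D : Matrix (Fin 3) (Fin 3) ℂ) (m : Fin 3 → ℂ) (h1 : m 1 = 1)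
    (hl : ∀ j, ∑ i, m i * D i j = 0) (hr : ∀ i, ∑ j, m j * D i j = 0) :
    D.adjugate = (D 0 0 * D 2 2 - D 0 2 * D 2 0) • Matrix.vecMulVec m m ∧
    D - D.transpose = (D 0 2 - D 2 0) • crs m := by
  simp only [Fin.sum_univ_three, h1, one_mul] at hl hr
  have e0 : D 0 1 = - m 0 * D 0 0 - m 2 * D 0 2 := by linear_combination hr 0
  have e2 : D 2 1 = - m 0 * D 2 0 - m 2 * D 2 2 := by linear_combination hr 2
  have f0 : D 1 0 = - m 0 * D 0 0 - m 2 * D 2 0 := by linear_combination hl 0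
  have f2 : D 1 2 = - m 0 * D 0 2 - m 2 * D 2 2 := by linear_combination hl 2
  have e1 : D 1 1 = - m 0 * D 1 0 - m 2 * D 1 2 := by linear_combination hr 1
  rw [f0, f2] at e1
  rw [Matrix.adjugate_fin_three]
  constructor
  · ext i j
    fin_cases i <;> fin_cases j <;>
      simp [Matrix.vecMulVec_apply, h1, e0, e2, f0, f2, e1] <;> ring
  · ext i j
    fin_cases i <;> fin_cases j <;>
      simp [crs, h1, e0, e2, f0, f2, e1] <;> ring

lemma BB_of_GG {Ω : Fin 3 → MvPolynomial (Fin 3) ℂ} (hΩ : ∀ i, (Ω i).IsHomogeneous 4)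
    (hrad : X 0 * Ω 0 + X 1 * Ω 1 + X 2 * Ω 2 = 0) {c : EE} {v : ℂ × ℂ} (hc : Pc c = Ω)
    (h0 : GG (c, v) = 0) (hd : dl (c, v) ≠ 0) : BBat Ω (pt v) (ta (c, v) ^ 2 / dl (c, v)) := by
  subst hc
  have hz0 : eval (pt v) (Pc c 0) = 0 := congrArg Prod.fst h0
  have hz2 : eval (pt v) (Pc c 2) = 0 := congrArg Prod.snd h0
  have hp1 : pt v 1 = 1 := rfl
  have hz1 : eval (pt v) (Pc c 1) = 0 := by
    have := congrArg (eval (pt v)) hrad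
    simpa [hz0, hz2, hp1] using this
  have hz : ∀ l, eval (pt v) (Pc c l) = 0 := by
    intro l; fin_cases l <;> assumption
  obtain ⟨hA, hT⟩ := alg_BB (Jm (Pc c) (pt v)) (pt v) hp1 (by
    intro j
    have := congrArg (fun q => eval (pt v) (pderiv j q)) hrad
    simpa [Derivation.leibniz, hz, Jm, Fin.sum_univ_three] using this) (by
    intro i
    have := congrArg (eval (pt v)) (hΩ i).sum_X_mul_pderiv
    simpa [hz, Jm] using this)
  refine ⟨dl (c, v), ta (c, v), ?_, hz, hd, ?_, hA, hT⟩
  · intro h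
    have := congrFun h 1
    simp [hp1] at this
  · field_simp

lemma orbit_hom {Ω Ω' : Fin 3 → MvPolynomial (Fin 3) ℂ} (hΩ : ∀ i, (Ω i).IsHomogeneous 4)
    (hrad : X 0 * Ω 0 + X 1 * Ω 1 + X 2 * Ω 2 = 0) (h : LinConj3 Ω Ω') :
    (∀ i, (Ω' i).IsHomogeneous 4) ∧ X 0 * Ω' 0 + X 1 * Ω' 1 + X 2 * Ω' 2 = 0 := by
  obtain ⟨M, c, hM, hc, hpb⟩ := h
  have hcc : (C c⁻¹ * C c : MvPolynomial (Fin 3) ℂ) = 1 := by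
    rw [← C_mul, inv_mul_cancel₀ hc, C_1]
  have hinv : ∀ i, Ω' i = C c⁻¹ * pb3 M Ω i := by
    intro i
    rw [hpb, ← mul_assoc, hcc, one_mul]
  constructor
  · intro i
    rw [hinv]
    refine IsHomogeneous.C_mul ?_ _
    refine IsHomogeneous.sum _ _ _ fun j _ => IsHomogeneous.C_mul ?_ _
    have := (hΩ j).aeval (fun i => ∑ j, C (M i j) * X j : Fin 3 → MvPolynomial (Fin 3) ℂ)
      (n := 1) (fun i => IsHomogeneous.sum _ _ _ fun l _ =>
        IsHomogeneous.C_mul (isHomogeneous_X _ _) _)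
    simpa [subst3] using this
  · have h1 := congrArg (aeval (fun i => ∑ j, C (M i j) * X j :
      Fin 3 → MvPolynomial (Fin 3) ℂ)) hrad
    simp only [map_add, map_mul, aeval_X, map_zero, Fin.sum_univ_three] at h1
    simp only [hinv, pb3, subst3, Fin.sum_univ_three]
    linear_combination (C c⁻¹) * h1

lemma cont_Rc : Continuous Rc := by
  unfold Rc
  fun_prop

/-- **Necessary condition for degenerating onto `F₁`.**
If a degree-3 foliation `F` degenerates onto `F₁` (i.e. `O(F₁)` is contained in the
closure of `O(F)` in `F(3)` and `O(F) ≠ O(F₁)`), then `F` has a nondegenerate singular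
point `m` with `BB(F, m) = 4`. -/
theorem stmt_13 (Ω : Fin 3 → MvPolynomial (Fin 3) ℂ)
    (hfol : IsFolDeg 3 Ω)
    (hdeg : OrbitOf OmF1 ⊆ FClos 3 (OrbitOf Ω))
    (hne : OrbitOf Ω ≠ OrbitOf OmF1) :
    NdBB4 Ω := by
  classical
  obtain ⟨-, hhom, hrad, -⟩ := hfol
  have hself : OmF1 ∈ OrbitOf OmF1 := by
    refine ⟨1, 1, by simp, one_ne_zero, ?_⟩
    funext i
    simp [pb3, subst3, Matrix.one_apply, apply_ite]
  have hcl := (hdeg hself).2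
  have hfin := finite_BB (Ω := Ω) hhom
  suffices h4 : (4 : ℂ) ∈ {β | ∃ m, BBat Ω m β} by
    obtain ⟨m, hm⟩ := h4
    exact BBat_nd hhom hm
  rw [← hfin.isClosed.closure_eq, mem_closure_iff_nhds]
  intro W hW
  have hdc : Continuous dl := by
    unfold dl
    exact ((cont_J 0 0).mul (cont_J 2 2)).sub ((cont_J 0 2).mul (cont_J 2 0))
  have htc : Continuous ta := by
    unfold ta
    exact (cont_J 0 2).sub (cont_J 2 0)
  have hd0 : dl (c0, (0, 0)) = 1 := by
    simp only [dl, Jm, Pc_c0]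
    simp [OmF1, pt, Derivation.leibniz, pderiv_X, Pi.single_apply]
  have ht0 : ta (c0, (0, 0)) = 2 := by
    simp only [ta, Jm, Pc_c0]
    simp [OmF1, pt, Derivation.leibniz, pderiv_X, Pi.single_apply]
    try norm_num
  have hd1 : dl (c0, (0, 0)) ≠ 0 := by rw [hd0]; exact one_ne_zero
  have hca : ContinuousAt (fun p => ta p ^ 2 / dl p) (c0, (0, 0)) :=
    (htc.pow 2).continuousAt.div hdc.continuousAt hd1
  have hW' : W ∈ nhds (ta (c0, (0, 0)) ^ 2 / dl (c0, (0, 0))) := by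
    rw [hd0, ht0]; norm_num; exact hW
  have hU := Filter.inter_mem (hca.preimage_mem_nhds hW') (hdc.continuousAt.eventually_ne hd1)
  have hev := GG_zero hU
  have hev2 := (cont_Rc.tendsto (_root_.coeffs OmF1)).eventually hev
  obtain ⟨_, ⟨v, hvU, hv0⟩, Ω', hΩ', rfl⟩ := mem_closure_iff_nhds.mp hcl _ hev2
  obtain ⟨hh, hr⟩ := orbit_hom hhom hrad hΩ'
  exact ⟨_, hvU.1, BBat_conj hΩ' (BB_of_GG hh hr (Pc_Rc hh) hv0 hvU.2)⟩
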